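/- Let Γ = Γ_{2,2,2} = {1324, 1423, 123}. Then for all n ≥ 0, U_{Γ,2n+1}(y) = Σ_{i=0}^{n} ( Π_{j=0}^{n−i−1} (2n−2j) )·(−y)^{n+1+i}, where the empty product (when i = n) equals 1. Equivalently, U_{Γ,2n+1}(y) = Σ_{i=0}^{n} (2n)↓↓_{n−i} (−y)^{n+1+i}, where (x)↓↓_0 = 1 and (x)↓↓_k = x(x−2)(x−4)⋯(x−2k+2). -/

import Mathlib

open Polynomial

/-- The reduction of a list of distinct integers: replace the i-th smallest entry by i. -/
def redL (l : List ℕ) : List ℕ :=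
  l.map (fun x => (l.countP (fun y => decide (y < x))) + 1)

/-- The number of descents of a list. -/
def desL (l : List ℕ) : ℕ :=
  (l.zip l.tail).countP (fun p => decide (p.2 < p.1))

/-- `σ` has a `Γ`-match: some consecutive factor of length at least 2 reduces to a member of `Γ`. -/
def HasMatch (Γ : Set (List ℕ)) (l : List ℕ) : Prop :=
  ∃ i j : ℕ, 1 ≤ j ∧ i + j + 1 ≤ l.length ∧ redL ((l.drop i).take (j + 1)) ∈ Γ

open scoped Classical in
/-- The set of permutations of `{1,…,n}` (in one-line notation, as lists) with no `Γ`-match. -/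
noncomputable def NMfinset (Γ : Set (List ℕ)) (n : ℕ) : Finset (List ℕ) :=
  ((List.range' 1 n).permutations.toFinset).filter (fun l => ¬ HasMatch Γ l)

/-- `NM_{Γ,n}(y) = Σ_{σ ∈ NM_n(Γ)} y^{1+des(σ)}` for `n ≥ 1`, and `NM_{Γ,0}(y) = 1`. -/
noncomputable def NMpoly (Γ : Set (List ℕ)) (n : ℕ) : Polynomial ℚ :=
  if n = 0 then 1 else ∑ l ∈ NMfinset Γ n, X ^ (1 + desL l)

namespace St8

mutual
noncomputable def ws : ℕ → List ℕ → ℚ[X]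
  | _, [] => X
  | a, c :: l => if c < a then X * (ws c l + wp c l) else 0
  termination_by _ l => (l.length, 1)
noncomputable def wp : ℕ → List ℕ → ℚ[X]
  | _, [] => 0
  | a, b :: l => if a < b then wq a b l else 0
  termination_by _ l => (l.length, 1)
noncomputable def wq : ℕ → ℕ → List ℕ → ℚ[X]
  | _, _, [] => X
  | c, b, d :: l => X * ((if d < b then ws d l else 0) + (if d < c then wp d l else 0))
  termination_by _ _ l => (l.length, 1)
end

noncomputable def PS (S : Finset ℕ) (f : List ℕ → ℚ[X]) : ℚ[X] := ∑ l ∈ S.val.lists.toFinset, f l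

lemma PS_empty (f) : PS ∅ f = f [] := by
  unfold PS
  rw [Finset.sum_eq_single_of_mem []]
  · simp [Multiset.mem_lists_iff]
  · intro b hb h
    exfalso; apply h
    rw [Multiset.mem_toFinset, Multiset.mem_lists_iff] at hb
    simpa using hb.symm

lemma mem_lists_cons (S : Finset ℕ) (a : ℕ) (l : List ℕ) :
    (a :: l) ∈ S.val.lists.toFinset ↔ a ∈ S ∧ l ∈ (S.erase a).val.lists.toFinset := by
  simp only [Multiset.mem_toFinset, Multiset.mem_lists_iff, Multiset.quot_mk_to_coe]
  constructor
  · intro h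
    have ha : a ∈ S := by rw [← Finset.mem_val, h]; simp
    refine ⟨ha, ?_⟩
    rw [Finset.erase_val, h]; simp
  · rintro ⟨ha, h⟩
    rw [← Multiset.cons_coe, ← h, Finset.erase_val, Multiset.cons_erase ha]

lemma PS_step (S : Finset ℕ) (hS : S ≠ ∅) (f) :
    PS S f = ∑ a ∈ S, PS (S.erase a) (fun l => f (a :: l)) := by
  unfold PS
  rw [Finset.sum_sigma']
  symm
  refine Finset.sum_bij (fun x _ => x.1 :: x.2) ?_ ?_ ?_ ?_
  · rintro ⟨a, l⟩ h
    rw [Finset.mem_sigma] at h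
    exact (mem_lists_cons S a l).2 h
  · rintro ⟨a, l⟩ h ⟨a', l'⟩ h' e
    simp only [List.cons.injEq] at e
    obtain ⟨rfl, rfl⟩ := e
    rfl
  · intro l hl
    cases l with
    | nil =>
      exfalso; apply hS
      rw [Multiset.mem_toFinset, Multiset.mem_lists_iff] at hl
      simpa using hl
    | cons a l => exact ⟨⟨a, l⟩, Finset.mem_sigma.2 ((mem_lists_cons S a l).1 hl), rfl⟩
  · intros; rfl

noncomputable def s (a : ℕ) (S : Finset ℕ) : ℚ[X] := PS S (ws a)
noncomputable def p (a : ℕ) (S : Finset ℕ) : ℚ[X] := PS S (wp a)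
noncomputable def q (a b : ℕ) (S : Finset ℕ) : ℚ[X] := PS S (wq a b)
noncomputable def nn (a : ℕ) (S : Finset ℕ) : ℚ[X] := s a S + p a S
noncomputable def N (S : Finset ℕ) : ℚ[X] :=
  (if S = ∅ then 1 else 0) + ∑ a ∈ S, nn a (S.erase a)

lemma PS_ite (S : Finset ℕ) (P : Prop) [Decidable P] (f : List ℕ → ℚ[X]) :
    PS S (fun l => if P then f l else 0) = if P then PS S f else 0 := by
  unfold PS; split_ifs <;> simp

lemma PS_add (S : Finset ℕ) (f g : List ℕ → ℚ[X]) :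
    PS S (fun l => f l + g l) = PS S f + PS S g := by
  unfold PS; rw [Finset.sum_add_distrib]

lemma PS_mul (S : Finset ℕ) (c : ℚ[X]) (f : List ℕ → ℚ[X]) :
    PS S (fun l => c * f l) = c * PS S f := by
  unfold PS; rw [Finset.mul_sum]

lemma s_eq (a : ℕ) (S : Finset ℕ) : s a S = (if S = ∅ then X else 0) +
    X * ∑ c ∈ S, if c < a then nn c (S.erase c) else 0 := by
  by_cases h : S = ∅
  · subst h; simp [s, PS_empty, ws]
  · simp only [s, nn, p, h, if_false, zero_add]
    rw [PS_step S h]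
    simp only [ws, PS_ite, PS_mul, PS_add, Finset.mul_sum, mul_ite, mul_zero]

lemma p_eq (a : ℕ) (S : Finset ℕ) : p a S = ∑ b ∈ S, if a < b then q a b (S.erase b) else 0 := by
  by_cases h : S = ∅
  · subst h; simp [p, PS_empty, wp]
  · simp only [p, q]
    rw [PS_step S h]
    simp only [wp, PS_ite]

lemma q_eq (c b : ℕ) (S : Finset ℕ) : q c b S = (if S = ∅ then X else 0) +
    X * ∑ d ∈ S, ((if d < b then s d (S.erase d) else 0) + (if d < c then p d (S.erase d) else 0)) := by
  by_cases h : S = ∅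
  · subst h; simp [q, PS_empty, wq]
  · simp only [s, q, p, h, if_false, zero_add]
    rw [PS_step S h]
    simp only [wq, PS_ite, PS_mul, PS_add, Finset.mul_sum]

lemma swap (S : Finset ℕ) (F : ℕ → Finset ℕ → Finset ℕ → ℚ[X]) :
    ∑ T ∈ S.powerset, ∑ c ∈ T, F c (T.erase c) (S \ T) =
    ∑ c ∈ S, ∑ T ∈ (S.erase c).powerset, F c T ((S.erase c) \ T) := by
  rw [Finset.sum_sigma', Finset.sum_sigma']
  refine Finset.sum_bij' (fun x _ => ⟨x.2, x.1.erase x.2⟩) (fun x _ => ⟨insert x.1 x.2, x.1⟩) ?_ ?_ ?_ ?_ ?_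
  · rintro ⟨T, c⟩ h
    simp only [Finset.mem_sigma, Finset.mem_powerset] at h ⊢
    exact ⟨h.1 h.2, Finset.erase_subset_erase _ h.1⟩
  · rintro ⟨c, T⟩ h
    simp only [Finset.mem_sigma, Finset.mem_powerset] at h ⊢
    refine ⟨Finset.insert_subset h.1 (h.2.trans (Finset.erase_subset _ _)), Finset.mem_insert_self _ _⟩
  · rintro ⟨T, c⟩ h
    simp only [Finset.mem_sigma, Finset.mem_powerset] at h
    simp [Finset.insert_erase h.2]
  · rintro ⟨c, T⟩ h
    simp only [Finset.mem_sigma, Finset.mem_powerset] at h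
    have : c ∉ T := fun hc => by simpa using h.2 hc
    simp [Finset.erase_insert this]
  · rintro ⟨T, c⟩ h
    simp only [Finset.mem_sigma, Finset.mem_powerset] at h
    congr 1
    ext x
    simp only [Finset.mem_sdiff, Finset.mem_erase]
    constructor
    · rintro ⟨h1, h2⟩
      exact ⟨⟨fun e => h2 (e ▸ h.2), h1⟩, fun h3 => h2 h3.2⟩
    · rintro ⟨⟨h1, h2⟩, h3⟩
      exact ⟨h2, fun h4 => h3 ⟨h1, h4⟩⟩

lemma sum_empty_term (S : Finset ℕ) (x : ℚ[X]) (g : Finset ℕ → ℚ[X]) :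
    ∑ T ∈ S.powerset, (if T = ∅ then x else 0) * g (S \ T) = x * g S := by
  rw [Finset.sum_eq_single_of_mem ∅]
  · simp
  · simp
  · intro b _ hb; simp [hb]

lemma sum_ins (S : Finset ℕ) (m : ℕ) (hm : m ∉ S) (F : ℕ → Finset ℕ → ℚ[X]) :
    ∑ c ∈ insert m S, F c ((insert m S).erase c) = F m S + ∑ c ∈ S, F c (insert m (S.erase c)) := by
  rw [Finset.sum_insert hm, Finset.erase_insert hm]
  congr 1
  refine Finset.sum_congr rfl fun c hc => ?_
  rw [Finset.erase_insert_of_ne]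
  rintro rfl; exact hm hc

/-- convolution with the part starting at the minimum -/
lemma conv_step (S : Finset ℕ) (g : Finset ℕ → ℚ[X]) (x : ℚ[X]) (F : ℕ → Finset ℕ → ℚ[X]) :
    ∑ T ∈ S.powerset, ((if T = ∅ then x else 0) + ∑ c ∈ T, F c (T.erase c)) * g (S \ T) =
    x * g S + ∑ c ∈ S, ∑ T ∈ (S.erase c).powerset, F c T * g ((S.erase c) \ T) := by
  rw [← swap S (fun c T R => F c T * g R), ← sum_empty_term, ← Finset.sum_add_distrib]
  refine Finset.sum_congr rfl fun T _ => ?_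
  rw [add_mul, Finset.sum_mul]

lemma split_min (m : ℕ) (k : ℕ) : ∀ S : Finset ℕ, S.card = k → (∀ x ∈ S, m < x) →
    (∀ a, m < a → s a (insert m S) = ∑ T ∈ S.powerset, s a T * nn m (S \ T)) ∧
    (∀ a, m < a → p a (insert m S) = ∑ T ∈ S.powerset, p a T * nn m (S \ T)) ∧
    (∀ a b, m < a → m < b → q a b (insert m S) = ∑ T ∈ S.powerset, q a b T * nn m (S \ T)) := by
  induction k using Nat.strong_induction_on with
  | _ k ih =>
  intro S hk hS
  have hm : m ∉ S := fun h => lt_irrefl _ (hS m h)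
  have hne : insert m S ≠ ∅ := Finset.insert_ne_empty _ _
  have IH : ∀ c ∈ S, _ := fun c hc => ih (S.erase c).card
    (by rw [← hk]; exact Finset.card_erase_lt_of_mem hc) (S.erase c) rfl
      (fun x hx => hS x (Finset.mem_of_mem_erase hx))
  refine ⟨?_, ?_, ?_⟩
  · intro a ha
    have e : ∀ T, s a T = (if T = ∅ then X else 0) +
        ∑ c ∈ T, (fun c R => if c < a then X * nn c R else 0) c (T.erase c) := by
      intro T; rw [s_eq, Finset.mul_sum]; simp
    simp only [e]
    rw [conv_step S (nn m) X (fun c R => if c < a then X * nn c R else 0), sum_ins S m hm (fun c R => if c < a then X * nn c R else 0)]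
    simp only [hne, if_false, ha, if_true, zero_add]
    congr 1
    refine Finset.sum_congr rfl fun c hc => ?_
    split_ifs with h
    · have := IH c hc
      rw [nn, this.1 c (hS c hc), this.2.1 c (hS c hc), ← Finset.sum_add_distrib, Finset.mul_sum]
      refine Finset.sum_congr rfl fun T _ => ?_
      rw [nn, nn]; ring
    · simp
  · intro a ha
    have e : ∀ T, p a T = (if T = ∅ then 0 else 0) +
        ∑ c ∈ T, (fun c R => if a < c then q a c R else 0) c (T.erase c) := by
      intro T; rw [p_eq]; simp
    simp only [e]
    rw [conv_step S (nn m) 0 (fun c R => if a < c then q a c R else 0), sum_ins S m hm (fun c R => if a < c then q a c R else 0)]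
    simp only [ha.not_gt, if_false, ite_self, zero_add, zero_mul]
    refine Finset.sum_congr rfl fun c hc => ?_
    split_ifs with h
    · exact (IH c hc).2.2 a c ha (hS c hc)
    · simp
  · intro a b ha hb
    have e : ∀ T, q a b T = (if T = ∅ then X else 0) +
        ∑ c ∈ T, (fun c R => X * ((if c < b then s c R else 0) + (if c < a then p c R else 0)))
          c (T.erase c) := by
      intro T; rw [q_eq, Finset.mul_sum]
    simp only [e]
    rw [conv_step S (nn m) X
      (fun c R => X * ((if c < b then s c R else 0) + (if c < a then p c R else 0))), sum_ins S m hm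
      (fun c R => X * ((if c < b then s c R else 0) + (if c < a then p c R else 0)))]
    simp only [hne, if_false, ha, hb, if_true, zero_add]
    rw [← nn]
    congr 1
    refine Finset.sum_congr rfl fun c hc => ?_
    have := IH c hc
    rw [this.1 c (hS c hc), this.2.1 c (hS c hc)]
    have e2 : ∀ (P Q : Prop) [Decidable P] [Decidable Q] (f g h : Finset ℕ → ℚ[X]) (A : Finset (Finset ℕ)),
      X * ((if P then ∑ T ∈ A, f T * h T else 0) + (if Q then ∑ T ∈ A, g T * h T else 0)) =
      ∑ T ∈ A, X * ((if P then f T else 0) + (if Q then g T else 0)) * h T := by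
      intro P Q _ _ f g h A
      split_ifs <;> simp [Finset.mul_sum, ← Finset.sum_add_distrib, mul_assoc, add_mul, mul_add]
    exact e2 _ _ _ _ _ _

lemma N_split (m : ℕ) (S : Finset ℕ) (hS : ∀ x ∈ S, m < x) :
    N (insert m S) = ∑ T ∈ S.powerset, N T * nn m (S \ T) := by
  have hm : m ∉ S := fun h => lt_irrefl _ (hS m h)
  simp only [N]
  rw [conv_step, sum_ins S m hm]
  simp only [Finset.insert_ne_empty, if_false, zero_add, one_mul]
  congr 1
  refine Finset.sum_congr rfl fun c hc => ?_
  have := split_min m _ (S.erase c) rfl (fun x hx => hS x (Finset.mem_of_mem_erase hx))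
  rw [nn, this.1 c (hS c hc), this.2.1 c (hS c hc), ← Finset.sum_add_distrib]
  refine Finset.sum_congr rfl fun T _ => ?_
  rw [nn, nn]; ring

noncomputable def C2 (x : ℕ) (R : Finset ℕ) : ℚ[X] :=
  X * ∑ b ∈ R, if x < b then s x (R.erase b) else 0

noncomputable def C (S : Finset ℕ) : ℚ[X] := (if S = ∅ then X else 0) + ∑ x ∈ S, C2 x (S.erase x)

lemma swap2 (S : Finset ℕ) (F : ℕ → ℕ → Finset ℕ → ℚ[X]) :
    ∑ b ∈ S, ∑ d ∈ S.erase b, F b d ((S.erase b).erase d) =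
    ∑ d ∈ S, ∑ b ∈ S.erase d, F b d ((S.erase d).erase b) := by
  rw [Finset.sum_comm' (t' := S) (s' := fun d => S.erase d)]
  · refine Finset.sum_congr rfl fun d _ => Finset.sum_congr rfl fun b _ => ?_
    rw [Finset.erase_right_comm]
  · intro x y; simp only [Finset.mem_erase]; tauto

lemma nn_min (m : ℕ) (S : Finset ℕ) (hS : ∀ x ∈ S, m < x) :
    nn m S = C S + if S.card = 1 then X else 0 := by
  have e1 : s m S = if S = ∅ then X else 0 := by
    rw [s_eq, Finset.sum_eq_zero]; · simp
    intro c hc; simp [(hS c hc).not_gt]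
  have e2 : p m S = ∑ b ∈ S, ((if S.erase b = ∅ then X else 0) +
      ∑ d ∈ S.erase b, (fun b d R => if d < b then X * s d R else 0) b d ((S.erase b).erase d)) := by
    rw [p_eq]
    refine Finset.sum_congr rfl fun b hb => ?_
    rw [if_pos (hS b hb), q_eq, Finset.mul_sum]
    congr 1
    refine Finset.sum_congr rfl fun d hd => ?_
    simp [(hS d (Finset.mem_of_mem_erase hd)).not_gt]
  have e3 : ∑ b ∈ S, (if S.erase b = ∅ then (X : ℚ[X]) else 0) = if S.card = 1 then X else 0 := by
    by_cases h : S.card = 1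
    · obtain ⟨a, rfl⟩ := Finset.card_eq_one.1 h
      simp
    · rw [if_neg h]
      refine Finset.sum_eq_zero fun b hb => ?_
      rw [if_neg]
      intro h2; apply h
      have h3 := Finset.card_erase_add_one hb
      rw [h2] at h3
      simpa using h3.symm
  rw [nn, e1, e2, Finset.sum_add_distrib, e3, swap2 S (fun b d R => if d < b then X * s d R else 0), C]
  simp only [C2, Finset.mul_sum, mul_ite, mul_zero]
  ring

lemma q_s (x b : ℕ) (Q : Finset ℕ) (hx : x ∉ Q) (hb : x < b) :
    q x b Q = s x Q + X * ∑ d ∈ Q, if x < d ∧ d < b then s d (Q.erase d) else 0 := by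
  rw [q_eq, s_eq, add_assoc, ← mul_add, ← Finset.sum_add_distrib]
  congr 2
  refine Finset.sum_congr rfl fun d hd => ?_
  have : d ≠ x := by rintro rfl; exact hx hd
  rcases lt_or_gt_of_ne this with h | h
  · simp [h, h.trans hb, nn, h.not_gt]
  · simp [h, h.not_gt]

lemma p_C2 (x : ℕ) (R : Finset ℕ) (hx : x ∉ R) :
    X * p x R = C2 x R + X * ∑ d ∈ R, if x < d then C2 d (R.erase d) else 0 := by
  rw [p_eq, C2, ← mul_add]
  congr 1
  have : ∀ d ∈ R, (if x < d then C2 d (R.erase d) else 0) =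
      ∑ b ∈ R.erase d, (fun b d T => if x < d ∧ d < b then X * s d T else 0) b d ((R.erase d).erase b) := by
    intro d hd
    simp only [C2, Finset.mul_sum]
    split_ifs with h <;> simp [h]
  rw [Finset.sum_congr rfl this, ← swap2 R (fun b d T => if x < d ∧ d < b then X * s d T else 0), ← Finset.sum_add_distrib]
  refine Finset.sum_congr rfl fun b hb => ?_
  split_ifs with h
  · rw [q_s x b _ (fun h => hx (Finset.mem_of_mem_erase h)) h]
    simp [Finset.mul_sum]
  · rw [Finset.sum_eq_zero]; · simp
    intro d _
    rw [if_neg]; omega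

lemma sum_max (R : Finset ℕ) : ∀ f : Finset ℕ → ℚ[X],
    ∑ T ∈ R.powerset, f T =
      f ∅ + ∑ c ∈ R, ∑ T ∈ (R.filter (· < c)).powerset, f (insert c T) := by
  induction R using Finset.induction_on_max with
  | empty => simp
  | insert M R hM ih =>
    intro f
    have hm : M ∉ R := fun h => lt_irrefl _ (hM M h)
    rw [Finset.sum_powerset_insert hm, ih, Finset.sum_insert hm]
    have h1 : (insert M R).filter (· < M) = R := by
      ext x; simp only [Finset.mem_filter, Finset.mem_insert]
      constructor
      · rintro ⟨rfl | h, h2⟩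
        · omega
        · exact h
      · intro h; exact ⟨Or.inr h, hM x h⟩
    have h2 : ∀ c ∈ R, (insert M R).filter (· < c) = R.filter (· < c) := by
      intro c hc
      rw [Finset.filter_insert, if_neg (hM c hc).not_gt]
    have h3 : ∑ c ∈ R, ∑ T ∈ ((insert M R).filter (· < c)).powerset, f (insert c T) =
        ∑ c ∈ R, ∑ T ∈ (R.filter (· < c)).powerset, f (insert c T) :=
      Finset.sum_congr rfl (fun c hc => by rw [h2 c hc])
    rw [h1, h3]
    ring

noncomputable def E (a : ℕ) (S : Finset ℕ) : ℚ[X] :=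
  ∑ T ∈ (S.filter (· < a)).powerset, X ^ T.card * C (S \ T)

lemma E_eq (a : ℕ) (S : Finset ℕ) :
    E a S = C S + ∑ c ∈ S, if c < a then X * E c (S.erase c) else 0 := by
  rw [E, sum_max, Finset.sum_filter]
  simp only [Finset.card_empty, pow_zero, one_mul, Finset.sdiff_empty]
  congr 1
  refine Finset.sum_congr rfl fun c hc => ?_
  split_ifs with h
  · rw [E, Finset.mul_sum]
    have : (S.filter (· < a)).filter (· < c) = (S.erase c).filter (· < c) := by
      ext x; simp only [Finset.mem_filter, Finset.mem_erase]
      constructor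
      · rintro ⟨⟨h1, h2⟩, h3⟩; exact ⟨⟨by omega, h1⟩, h3⟩
      · rintro ⟨⟨h1, h2⟩, h3⟩; exact ⟨⟨h2, by omega⟩, h3⟩
    rw [this]
    refine Finset.sum_congr rfl fun T hT => ?_
    have hc' : c ∉ T := by
      intro h'
      have := Finset.mem_powerset.1 hT h'
      simp at this
    have e : S \ insert c T = (S.erase c) \ T := by
      ext x; simp only [Finset.mem_sdiff, Finset.mem_insert, Finset.mem_erase]; tauto
    rw [Finset.card_insert_of_notMem hc', e, pow_succ]
    ring
  · rfl

lemma s_E (k : ℕ) : ∀ (S : Finset ℕ), S.card = k → ∀ a,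
    s a S = E a S - ∑ d ∈ S, if d < a then 0 else C2 d (S.erase d) := by
  induction k using Nat.strong_induction_on with
  | _ k ih =>
  intro S hk a
  have h1 : ∀ c ∈ S, X * nn c (S.erase c) = C2 c (S.erase c) + X * E c (S.erase c) := by
    intro c hc
    rw [nn, mul_add, p_C2 _ _ (Finset.notMem_erase c S),
      ih (S.erase c).card (by rw [← hk]; exact Finset.card_erase_lt_of_mem hc) (S.erase c) rfl c]
    have : ∑ d ∈ S.erase c, (if d < c then 0 else C2 d ((S.erase c).erase d)) =
      ∑ d ∈ S.erase c, (if c < d then C2 d ((S.erase c).erase d) else 0) := by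
      refine Finset.sum_congr rfl fun d hd => ?_
      have := Finset.ne_of_mem_erase hd
      split_ifs <;> first | rfl | omega
    rw [this]; ring
  rw [s_eq, E_eq, C, Finset.mul_sum]
  have h2 : ∑ c ∈ S, X * (if c < a then nn c (S.erase c) else 0) =
    ∑ c ∈ S, (C2 c (S.erase c) + (if c < a then X * E c (S.erase c) else 0) -
      (if c < a then 0 else C2 c (S.erase c))) := by
    refine Finset.sum_congr rfl fun c hc => ?_
    split_ifs with h
    · rw [h1 c hc]; ring
    · ring
  rw [h2, Finset.sum_sub_distrib, Finset.sum_add_distrib]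
  ring

lemma N_C (S : Finset ℕ) : X * N S = ∑ T ∈ S.powerset, X ^ T.card * C (S \ T) := by
  obtain ⟨a, ha⟩ : ∃ a, ∀ x ∈ S, x < a := ⟨S.sup id + 1, fun x hx =>
    Nat.lt_succ_of_le (Finset.le_sup (f := id) hx)⟩
  have h := s_E _ S rfl a
  rw [E, Finset.filter_true_of_mem ha, Finset.sum_eq_zero (s := S), sub_zero] at h
  · have e : ∑ c ∈ S, (if c < a then nn c (S.erase c) else 0) = ∑ c ∈ S, nn c (S.erase c) :=
      Finset.sum_congr rfl (fun c hc => by rw [if_pos (ha c hc)])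
    rw [← h, s_eq, N, e]
    split_ifs <;> ring
  · intro d hd; simp [ha d hd]

lemma sum_card (R : Finset ℕ) (g : Finset ℕ → ℚ[X]) (f : ℕ → ℚ[X])
    (h : ∀ T ∈ R.powerset, g T = f T.card) :
    ∑ T ∈ R.powerset, g T = ∑ j ∈ Finset.range (R.card + 1), R.card.choose j • f j := by
  rw [Finset.sum_congr rfl h]
  exact Finset.sum_powerset_apply_card f

/-- Values depend only on the cardinality. -/
lemma C_card_of (n : ℕ) (hN : ∀ S : Finset ℕ, S.card ≤ n → N S = N (Finset.range S.card)) :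
    ∀ k ≤ n, ∀ S : Finset ℕ, S.card = k → C S = C (Finset.range k) := by
  intro k
  induction k using Nat.strong_induction_on with
  | _ k ih =>
  intro hk S hS
  have key : ∀ R : Finset ℕ, R.card = k → C R = X * N (Finset.range k) -
      ∑ j ∈ Finset.range (k + 1), (if j = 0 then 0 else
        k.choose j • (X ^ j * C (Finset.range (k - j)))) := by
    intro R hR
    have h := N_C R
    rw [hN R (by omega), hR] at h
    rw [h]
    have h2 : ∀ T ∈ R.powerset, X ^ T.card * C (R \ T) =
       (if T = ∅ then C R else 0) +
        (fun j => if j = 0 then 0 else X ^ j * C (Finset.range (k - j))) T.card := by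
      intro T hT
      by_cases h0 : T = ∅
      · subst h0; simp
      · have h1 : 0 < T.card := Finset.card_pos.2 (Finset.nonempty_iff_ne_empty.2 h0)
        have h3 : (R \ T).card = k - T.card := by
          rw [Finset.card_sdiff_of_subset (Finset.mem_powerset.1 hT), hR]
        have h4 := Finset.card_le_card (Finset.mem_powerset.1 hT)
        simp only [h0, if_false, h1.ne', zero_add]
        rw [ih (k - T.card) (by omega) (by omega) _ h3]
    rw [Finset.sum_congr rfl h2, Finset.sum_add_distrib, Finset.sum_ite_eq', if_pos (by simp),
      sum_card R _ (fun j => if j = 0 then 0 else X ^ j * C (Finset.range (k - j))) (fun _ _ => rfl), hR]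
    simp
  rw [key S hS, key _ (by simp)]

lemma N_card (n : ℕ) : ∀ S : Finset ℕ, S.card ≤ n → N S = N (Finset.range S.card) := by
  induction n with
  | zero =>
    intro S hS
    have : S = ∅ := by simpa using hS
    subst this; simp
  | succ n ih =>
    intro S hS
    rcases Nat.lt_or_ge S.card (n+1) with h | h
    · exact ih S (by omega)
    have hS' : S.card = n + 1 := by omega
    have hC := C_card_of n ih
    have key : ∀ R : Finset ℕ, R.card = n + 1 → N R =
      ∑ j ∈ Finset.range (n + 1), n.choose j • (N (Finset.range j) *
        (C (Finset.range (n - j)) + if n - j = 1 then X else 0)) := by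
      intro R hR
      have hne : R.Nonempty := Finset.card_pos.1 (by omega)
      set m := R.min' hne with hm
      have hmR : m ∈ R := Finset.min'_mem _ _
      have hR' : (R.erase m).card = n := by rw [Finset.card_erase_of_mem hmR]; omega
      have hlt : ∀ x ∈ R.erase m, m < x := fun x hx => Finset.min'_lt_of_mem_erase_min' R hne hx
      conv_lhs => rw [← Finset.insert_erase hmR]
      rw [N_split m _ hlt]
      have h2 : ∀ T ∈ (R.erase m).powerset, N T * nn m (R.erase m \ T) =
          (fun j => N (Finset.range j) *
        (C (Finset.range (n - j)) + if n - j = 1 then X else 0)) T.card := by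
        intro T hT
        have hT' := Finset.mem_powerset.1 hT
        have h4 := Finset.card_le_card hT'
        have h3 : (R.erase m \ T).card = n - T.card := by
          rw [Finset.card_sdiff_of_subset hT', hR']
        rw [nn_min m _ (fun x hx => hlt x (Finset.mem_sdiff.1 hx).1), ih T (by omega),
          hC (n - T.card) (by omega) _ h3, h3]
      rw [sum_card _ _ (fun j => N (Finset.range j) *
        (C (Finset.range (n - j)) + if n - j = 1 then X else 0)) h2, hR']
    rw [key S hS', hS', key _ (by simp)]

noncomputable def aa (n : ℕ) : ℚ[X] := N (Finset.range n)
noncomputable def cc (n : ℕ) : ℚ[X] := C (Finset.range n)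

lemma N_aa (S : Finset ℕ) : N S = aa S.card := N_card _ S le_rfl
lemma C_cc (S : Finset ℕ) : C S = cc S.card :=
  C_card_of S.card (fun R _ => N_card _ R le_rfl) _ le_rfl S rfl

lemma aa_cc (n : ℕ) :
    X * aa n = ∑ j ∈ Finset.range (n + 1), n.choose j • (X ^ j * cc (n - j)) := by
  have h := N_C (Finset.range n)
  rw [← aa] at h
  rw [h]
  have h2 : ∀ T ∈ (Finset.range n).powerset, X ^ T.card * C (Finset.range n \ T) =
      (fun j => X ^ j * cc (n - j)) T.card := by
    intro T hT
    rw [C_cc, Finset.card_sdiff_of_subset (Finset.mem_powerset.1 hT), Finset.card_range]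
  rw [sum_card _ _ (fun j => X ^ j * cc (n - j)) h2, Finset.card_range]

lemma aa_succ (n : ℕ) :
    aa (n + 1) = ∑ j ∈ Finset.range (n + 1), n.choose j • (aa j *
        (cc (n - j) + if n - j = 1 then X else 0)) := by
  have hlt : ∀ x ∈ Finset.Icc 1 n, 0 < x := fun x hx => (Finset.mem_Icc.1 hx).1
  have h := N_split 0 (Finset.Icc 1 n) hlt
  rw [N_aa, Finset.card_insert_of_notMem (by simp), Nat.card_Icc] at h
  simp only [Nat.add_sub_cancel] at h
  rw [h]
  have h2 : ∀ T ∈ (Finset.Icc 1 n).powerset, N T * nn 0 (Finset.Icc 1 n \ T) =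
      (fun j => aa j * (cc (n - j) + if n - j = 1 then X else 0)) T.card := by
    intro T hT
    have hT' := Finset.mem_powerset.1 hT
    rw [nn_min 0 _ (fun x hx => hlt x (Finset.mem_sdiff.1 hx).1), N_aa, C_cc,
      Finset.card_sdiff_of_subset hT', Nat.card_Icc, Nat.add_sub_cancel]
  rw [sum_card _ _ (fun j => aa j * (cc (n - j) + if n - j = 1 then X else 0)) h2, Nat.card_Icc, Nat.add_sub_cancel]

/-- The head of the list starts a match. -/
def HB : List ℕ → Prop
  | a :: b :: c :: l => (a < b ∧ b < c) ∨ (a < b ∧ a < c ∧ c < b ∧ ∃ d, l.head? = some d ∧ c < d)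
  | _ => False

abbrev G : Set (List ℕ) := {[1, 3, 2, 4], [1, 4, 2, 3], [1, 2, 3]}

lemma hasMatch_cons (a : ℕ) (l : List ℕ) :
    HasMatch G (a :: l) ↔
      (∃ j, 1 ≤ j ∧ j ≤ l.length ∧ redL ((a :: l).take (j + 1)) ∈ G) ∨ HasMatch G l := by
  constructor
  · rintro ⟨i, j, h1, h2, h3⟩
    cases i with
    | zero => left; exact ⟨j, h1, by simpa using h2, by simpa using h3⟩
    | succ i => right; exact ⟨i, j, h1, by simp at h2; omega, by simpa using h3⟩
  · rintro (⟨j, h1, h2, h3⟩ | ⟨i, j, h1, h2, h3⟩)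
    · exact ⟨0, j, h1, by simpa using h2, by simpa using h3⟩
    · exact ⟨i + 1, j, h1, by simp; omega, by simpa using h3⟩

lemma red3 (a b c : ℕ) (h1 : a ≠ b) (h2 : a ≠ c) (h3 : b ≠ c) :
    redL [a, b, c] = [1, 2, 3] ↔ a < b ∧ b < c := by
  simp only [redL, List.map_cons, List.map_nil, List.countP_cons, List.countP_nil, List.cons.injEq,
    decide_eq_true_eq]
  constructor
  · rintro ⟨e1, e2, e3, -⟩
    split_ifs at * <;> omega
  · rintro ⟨e1, e2⟩
    refine ⟨?_, ?_, ?_, trivial⟩ <;> split_ifs <;> omega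

lemma red4 (a b c d : ℕ) (h1 : a ≠ b) (h2 : a ≠ c) (h3 : b ≠ c) (h4 : a ≠ d) (h5 : b ≠ d) (h6 : c ≠ d) :
    (redL [a, b, c, d] = [1, 3, 2, 4] ∨ redL [a, b, c, d] = [1, 4, 2, 3]) ↔
      a < b ∧ a < c ∧ c < b ∧ c < d := by
  simp only [redL, List.map_cons, List.map_nil, List.countP_cons, List.countP_nil, List.cons.injEq,
    decide_eq_true_eq]
  constructor
  · rintro (⟨e1, e2, e3, e4, -⟩ | ⟨e1, e2, e3, e4, -⟩)
    · clear e2 e4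
      have f1 : a < b ∧ a < c := by split_ifs at e1 <;> omega
      clear e1
      split_ifs at e3 <;> omega
    · clear e2 e4
      have f1 : a < b ∧ a < c := by split_ifs at e1 <;> omega
      clear e1
      split_ifs at e3 <;> omega
  · rintro ⟨e1, e2, e3, e4⟩
    rcases lt_or_gt_of_ne h5 with h | h
    · left
      refine ⟨?_, ?_, ?_, ?_, trivial⟩ <;> split_ifs <;> omega
    · right
      refine ⟨?_, ?_, ?_, ?_, trivial⟩ <;> split_ifs <;> omega

lemma redL_length (l : List ℕ) : (redL l).length = l.length := by simp [redL]

lemma head_iff (a : ℕ) (l : List ℕ) (hl : (a :: l).Nodup) :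
    (∃ j, 1 ≤ j ∧ j ≤ l.length ∧ redL ((a :: l).take (j + 1)) ∈ G) ↔ HB (a :: l) := by
  have hlen : ∀ j, j ≤ l.length → redL ((a :: l).take (j + 1)) ∈ G → j = 2 ∨ j = 3 := by
    intro j hj h
    have e : (redL ((a :: l).take (j + 1))).length = j + 1 := by
      rw [redL_length, List.length_take]; simp; omega
    rcases h with h | h | h <;> rw [h] at e <;> simp at e <;> omega
  match l, hl, hlen with
  | [], _, _ => simp only [HB, iff_false]; rintro ⟨j, h1, h2, h3⟩; simp at h2; omega
  | [b], _, hlen =>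
    simp only [HB, iff_false]
    rintro ⟨j, h1, h2, h3⟩
    have := hlen j h2 h3
    simp at h2; omega
  | [b, c], hl, hlen =>
    simp at hl
    have r := red3 a b c (by tauto) (by tauto) (by tauto)
    simp only [HB, List.head?_nil]
    constructor
    · rintro ⟨j, h1, h2, h3⟩
      have := hlen j h2 h3
      have : j = 2 := by simp at h2; omega
      subst this
      left
      rw [← r]
      have e : (redL [a, b, c]).length = 3 := by rw [redL_length]; rfl
      rcases h3 with h | h | h
      · simp at h; rw [h] at e; simp at e
      · simp at h; rw [h] at e; simp at e
      · exact h
    · rintro (h | ⟨_, _, _, d, h, _⟩)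
      · exact ⟨2, by simp, by simp, by right; right; exact r.2 h⟩
      · simp at h
  | b :: c :: d :: l, hl, hlen =>
    simp at hl
    have r := red3 a b c (by tauto) (by tauto) (by tauto)
    have r4 := red4 a b c d (by tauto) (by tauto) (by tauto) (by tauto) (by tauto) (by tauto)
    simp only [HB, List.head?_cons, Option.some.injEq, exists_eq_left']
    rw [← r, ← r4]
    constructor
    · rintro ⟨j, h1, h2, h3⟩
      rcases hlen j h2 h3 with rfl | rfl
      · left
        have e : (redL [a, b, c]).length = 3 := by rw [redL_length]; rfl
        rcases h3 with h | h | h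
        · simp at h; rw [h] at e; simp at e
        · simp at h; rw [h] at e; simp at e
        · exact h
      · right
        have e : (redL [a, b, c, d]).length = 4 := by rw [redL_length]; rfl
        rcases h3 with h | h | h
        · left; exact h
        · right; exact h
        · simp at h; rw [h] at e; simp at e
    · rintro (h | h | h)
      · exact ⟨2, by simp, by simp, by right; right; exact h⟩
      · exact ⟨3, by simp, by simp, by left; exact h⟩
      · exact ⟨3, by simp, by simp, by right; left; exact h⟩

lemma match_cons (a : ℕ) (l : List ℕ) (hl : (a :: l).Nodup) :
    HasMatch G (a :: l) ↔ HB (a :: l) ∨ HasMatch G l := by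
  rw [hasMatch_cons, head_iff a l hl]

lemma match_nil : ¬ HasMatch G [] := by
  rintro ⟨i, j, h1, h2, h3⟩
  simp at h2

open scoped Classical in
noncomputable def val (l : List ℕ) : ℚ[X] := if HasMatch G l then 0 else X ^ (1 + desL l)

lemma des_cons (a b : ℕ) (l : List ℕ) :
    desL (a :: b :: l) = desL (b :: l) + if b < a then 1 else 0 := by
  simp [desL, List.countP_cons]

lemma val_single (a : ℕ) : val [a] = X := by
  have : ¬ HasMatch G [a] := by
    rw [match_cons a [] (by simp)]; simp [HB, match_nil]
  simp [val, this, desL]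

lemma val_desc (a b : ℕ) (l : List ℕ) (hl : (a :: b :: l).Nodup) (h : b < a) :
    val (a :: b :: l) = X * val (b :: l) := by
  have hb : ¬ HB (a :: b :: l) := by
    cases l with
    | nil => simp [HB]
    | cons c l => simp only [HB]; rintro (h1 | h1) <;> omega
  unfold val
  have e := match_cons a _ hl
  rw [des_cons]
  by_cases h1 : HasMatch G (b :: l)
  · rw [if_pos h1, if_pos (e.2 (Or.inr h1)), mul_zero]
  · rw [if_neg h1, if_neg (fun h2 => (e.1 h2).elim hb h1), if_pos h]
    ring

lemma val_asc (a b : ℕ) (l : List ℕ) (hl : (a :: b :: l).Nodup) (h : a < b) (hb : ¬ HB (a :: b :: l)) :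
    val (a :: b :: l) = val (b :: l) := by
  unfold val
  have e := match_cons a _ hl
  rw [des_cons]
  by_cases h1 : HasMatch G (b :: l)
  · rw [if_pos h1, if_pos (e.2 (Or.inr h1))]
  · rw [if_neg h1, if_neg (fun h2 => (e.1 h2).elim hb h1), if_neg h.not_gt, add_zero]

lemma val_zero (a : ℕ) (l : List ℕ) (hl : (a :: l).Nodup) (hb : HB (a :: l)) : val (a :: l) = 0 := by
  unfold val
  rw [match_cons a _ hl]
  simp [hb]

lemma w_val (k : ℕ) : ∀ l : List ℕ, l.length ≤ k →
    (∀ a, (a :: l).Nodup → ws a l + wp a l = val (a :: l)) ∧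
    (∀ a b, (a :: b :: l).Nodup → a < b → wq a b l = val (a :: b :: l)) := by
  induction k with
  | zero =>
    intro l hl
    have : l = [] := by simpa using hl
    subst this
    refine ⟨fun a _ => by simp [ws, wp, val_single], fun a b h hab => ?_⟩
    rw [wq, val_asc a b [] h hab (by simp [HB]), val_single]
  | succ k ih =>
    intro l hl
    cases l with
    | nil => exact ih [] (by simp)
    | cons c l =>
    have ihl := ih l (by simpa using hl)
    constructor
    · intro a hn
      have hn' : (c :: l).Nodup := hn.of_cons
      have hac : a ≠ c := by simp at hn; tauto
      rw [ws, wp]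
      rcases lt_or_gt_of_ne hac with h | h
      · rw [if_neg h.not_gt, if_pos h, zero_add, ihl.2 a c hn h]
      · rw [if_pos h, if_neg h.not_gt, add_zero, ihl.1 c hn', val_desc a c l hn h]
    · intro a b hn hab
      have hn' : (b :: c :: l).Nodup := hn.of_cons
      have hn2 : (c :: l).Nodup := hn'.of_cons
      have hac : a ≠ c := by simp at hn; tauto
      have hbc : b ≠ c := by simp at hn; tauto
      rw [wq]
      rcases lt_or_gt_of_ne hbc with h | h
      · rw [if_neg h.not_gt, if_neg (by omega), val_zero _ _ hn (by left; exact ⟨hab, h⟩)]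
        simp
      · rw [if_pos h]
        have e := ihl.1 c hn2
        cases l with
        | nil =>
          rw [val_asc _ _ _ hn hab (by simp [HB]; omega), val_desc _ _ _ hn' h, ← e]
          simp [wp]
        | cons d l =>
          have hcd : c ≠ d := by simp at hn; tauto
          rcases lt_or_gt_of_ne hcd with h2 | h2
          · have hs : ws c (d :: l) = 0 := by rw [ws, if_neg h2.not_gt]
            rw [hs, zero_add] at e
            rw [hs, zero_add]
            by_cases h3 : c < a
            · rw [if_pos h3, e, val_asc _ _ _ hn hab (by simp [HB]; omega), val_desc _ _ _ hn' h]
            · rw [if_neg h3, val_zero _ _ hn (by simp [HB]; omega), mul_zero]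
          · have hp : wp c (d :: l) = 0 := by rw [wp, if_neg h2.not_gt]
            rw [hp, add_zero] at e
            rw [hp, ite_self, add_zero, e, val_asc _ _ _ hn hab (by simp [HB]; omega),
              val_desc _ _ _ hn' h]

lemma NMpoly_eq (n : ℕ) : NMpoly G n = aa n := by
  by_cases hn : n = 0
  · subst hn; simp [NMpoly, aa, N]
  have e : aa n = N (Finset.Icc 1 n) := by rw [N_aa]; simp
  have hne : Finset.Icc 1 n ≠ ∅ := by
    rw [← Finset.nonempty_iff_ne_empty]; exact ⟨1, by simp; omega⟩
  have hv : (Finset.Icc 1 n).val = ((List.range' 1 n : List ℕ) : Multiset ℕ) := by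
    rfl
  have h1 : NMpoly G n = PS (Finset.Icc 1 n) val := by
    rw [NMpoly, if_neg hn, NMfinset, Finset.sum_filter, PS]
    refine Finset.sum_congr ?_ ?_
    · ext l
      simp only [List.mem_toFinset, List.mem_permutations, Multiset.mem_toFinset,
        Multiset.mem_lists_iff, hv, Multiset.quot_mk_to_coe, Multiset.coe_eq_coe]
      exact List.perm_comm
    · intro l _
      rw [val]
      split_ifs <;> rfl
  rw [e, h1, N, if_neg hne, zero_add, PS_step _ hne]
  refine Finset.sum_congr rfl fun a ha => ?_
  rw [nn, s, p, ← PS_add]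
  unfold PS
  refine Finset.sum_congr rfl fun l hl => ?_
  refine ((w_val l.length l le_rfl).1 a ?_).symm
  have h2 := (mem_lists_cons (Finset.Icc 1 n) a l).2 ⟨ha, hl⟩
  rw [Multiset.mem_toFinset, Multiset.mem_lists_iff] at h2
  have h3 := (Finset.Icc 1 n).nodup
  rw [h2] at h3
  simpa using h3

noncomputable def egf (f : ℕ → ℚ[X]) : PowerSeries ℚ[X] :=
  PowerSeries.mk fun n => ((n.factorial : ℚ)⁻¹) • f n

lemma egf_mul (f g h : ℕ → ℚ[X])
    (H : ∀ n, h n = ∑ k ∈ Finset.range (n + 1), n.choose k • (f k * g (n - k))) :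
    egf h = egf f * egf g := by
  ext1 n
  rw [PowerSeries.coeff_mul, Finset.Nat.sum_antidiagonal_eq_sum_range_succ_mk]
  simp only [egf, PowerSeries.coeff_mk]
  rw [H, Finset.smul_sum]
  refine Finset.sum_congr rfl fun k hk => ?_
  have hk' : k ≤ n := by simpa [Nat.lt_succ_iff] using hk
  rw [smul_mul_smul_comm, ← Nat.cast_smul_eq_nsmul ℚ, smul_smul]
  congr 1
  rw [Nat.cast_choose ℚ hk']
  have := Nat.factorial_ne_zero n
  have := Nat.factorial_ne_zero k
  have := Nat.factorial_ne_zero (n - k)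
  field_simp

lemma egf_inj (f g : ℕ → ℚ[X]) (h : egf f = egf g) (n : ℕ) : f n = g n := by
  have := congrArg (PowerSeries.coeff n) h
  simp only [egf, PowerSeries.coeff_mk] at this
  have h2 : ((n.factorial : ℚ)⁻¹) ≠ 0 := by positivity
  exact smul_right_injective _ h2 this

lemma egf_deriv (f : ℕ → ℚ[X]) :
    PowerSeries.derivative ℚ[X] (egf f) = egf (fun n => f (n + 1)) := by
  ext1 n
  rw [PowerSeries.coeff_derivative]
  simp only [egf, PowerSeries.coeff_mk]
  rw [Nat.factorial_succ, smul_mul_assoc]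
  have : f (n + 1) * ((n : ℚ[X]) + 1) = ((n : ℚ) + 1) • f (n + 1) := by
    rw [Algebra.smul_def]; simp; ring
  rw [this, smul_smul]
  congr 1
  push_cast
  have := Nat.factorial_ne_zero n
  field_simp

lemma deriv_inv {R : Type} [CommRing R] (f g : PowerSeries R) (h : 1 = f * g) :
    PowerSeries.derivative R f * g + f * PowerSeries.derivative R g = 0 := by
  have := congrArg (PowerSeries.derivative R) h
  rw [Derivation.leibniz] at this
  simp only [smul_eq_mul, Derivation.map_one_eq_zero] at this
  rw [this]; ring

lemma U_rec (u : ℕ → ℚ[X]) (h0 : u 0 = 1)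
    (hu : ∀ n, 1 ≤ n → ∑ k ∈ Finset.range (n + 1), n.choose k • (u k * aa (n - k)) = 0) (n : ℕ) :
    u (n + 1) = -(∑ k ∈ Finset.range (n + 1), n.choose k • (u k * (if n - k = 1 then X else 0)))
      - X * (-X) ^ n := by
  have haa0 : aa 0 = 1 := by simp [aa, N]
  set t : ℕ → ℚ[X] := fun n => if n = 1 then X else 0
  set x : ℕ → ℚ[X] := fun n => X ^ n
  set x' : ℕ → ℚ[X] := fun n => (-X) ^ n
  set d : ℕ → ℚ[X] := fun n => if n = 0 then 1 else 0
  have hd : egf d = 1 := by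
    ext1 n
    simp only [egf, PowerSeries.coeff_mk, PowerSeries.coeff_one, d]
    split_ifs with h
    · subst h; simp
    · simp
  have eUA : egf d = egf u * egf aa := by
    refine egf_mul _ _ _ fun n => ?_
    rcases Nat.eq_zero_or_pos n with rfl | h
    · simp [d, h0, haa0]
    · rw [hu n h]; simp [d]; omega
  have exc : egf (fun n => X * aa n) = egf x * egf cc := egf_mul _ _ _ aa_cc
  have exx : egf d = egf x' * egf x := by
    refine egf_mul _ _ _ fun n => ?_
    have h := add_pow (-X : ℚ[X]) X n
    simp only [neg_add_cancel] at h
    have e : d n = 0 ^ n := by simp [d, zero_pow_eq]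
    rw [e, h]
    refine Finset.sum_congr rfl fun k _ => ?_
    simp [x, x', nsmul_eq_mul]; ring
  have eX : egf (fun n => X * aa n) = PowerSeries.C (X : ℚ[X]) * egf aa := by
    ext1 n
    rw [PowerSeries.coeff_C_mul]
    simp [egf]
  have eX' : egf (fun n => X * x' n) = PowerSeries.C (X : ℚ[X]) * egf x' := by
    ext1 n
    rw [PowerSeries.coeff_C_mul]
    simp [egf]
  have edA : PowerSeries.derivative ℚ[X] (egf aa) = egf aa * egf (fun n => cc n + t n) := by
    rw [egf_deriv]
    exact egf_mul _ _ _ aa_succ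
  have eadd : egf (fun n => cc n + t n) = egf cc + egf t := by
    ext1 n; simp [egf]
  have ut : egf (fun n => ∑ k ∈ Finset.range (n + 1), n.choose k • (u k * t (n - k))) =
    egf u * egf t := egf_mul _ _ _ fun _ => rfl
  rw [hd] at eUA exx
  have hder : PowerSeries.derivative ℚ[X] (egf u) * egf aa +
      egf u * PowerSeries.derivative ℚ[X] (egf aa) = 0 := deriv_inv _ _ eUA
  have key : PowerSeries.derivative ℚ[X] (egf u) =
      -(egf u * egf t) - PowerSeries.C (X : ℚ[X]) * egf x' := by
    rw [edA, eadd] at hder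
    rw [eX] at exc
    generalize PowerSeries.derivative ℚ[X] (egf u) = D at *
    generalize egf u = u' at *
    generalize egf aa = A at *
    generalize egf cc = c at *
    generalize egf t = t' at *
    generalize egf x = y at *
    generalize egf x' = z at *
    generalize PowerSeries.C (X : ℚ[X]) = w at *
    have hc : c = z * w * A := by
      calc c = (z * y) * c := by rw [← exx, one_mul]
        _ = z * w * A := by rw [mul_assoc, ← exc]; ring
    have hDA : D = -(u' * (c + t')) := by
      have : D * A * u' = -(u' * A * (c + t')) * u' := by linear_combination u' * hder
      have e1 : D * A * u' = D := by rw [mul_assoc, mul_comm A, ← eUA, mul_one]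
      rw [e1, ← eUA] at this
      rw [this]; ring
    rw [hDA, hc]
    linear_combination (w * z) * eUA
  rw [egf_deriv, ← ut, ← eX'] at key
  have := egf_inj (fun n => u (n + 1)) (fun n => -(∑ k ∈ Finset.range (n + 1), n.choose k • (u k * t (n - k)))
      - X * x' n) (by rw [key]; ext1 n; simp [egf, smul_sub]) n
  exact this

lemma U_rec2 (u : ℕ → ℚ[X]) (h0 : u 0 = 1)
    (hu : ∀ n, 1 ≤ n → ∑ k ∈ Finset.range (n + 1), n.choose k • (u k * aa (n - k)) = 0) (n : ℕ) :
    u (n + 2) = - ((n : ℚ[X]) + 1) * X * u n + (-X) ^ (n + 2) := by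
  rw [U_rec u h0 hu (n + 1), Finset.sum_eq_single n]
  · simp [nsmul_eq_mul]; ring
  · intro k hk hkn
    rw [if_neg]
    · simp
    · simp at hk; omega
  · simp

end St8

theorem stmt8 (Γ : Set (List ℕ)) (hΓ : Γ = {[1, 3, 2, 4], [1, 4, 2, 3], [1, 2, 3]})
    (U : ℤ → Polynomial ℚ)
    (hUneg : ∀ m : ℤ, m < 0 → U m = 0)
    (hU0 : U 0 = 1)
    (hUrec : ∀ n : ℕ, 1 ≤ n →
      ∑ k ∈ Finset.range (n + 1), (n.choose k : ℚ) • (U (k : ℤ) * NMpoly Γ (n - k)) = 0) :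
    ∀ n : ℕ,
      U ((2 * n + 1 : ℕ) : ℤ) = ∑ i ∈ Finset.range (n + 1),
        ((∏ j ∈ Finset.range (n - i), (2 * n - 2 * j) : ℕ) : Polynomial ℚ) *
          (-X : Polynomial ℚ) ^ (n + 1 + i) := by
  have hG : Γ = St8.G := hΓ
  subst hG
  set u : ℕ → ℚ[X] := fun k => U (k : ℤ) with hu
  have hrec := St8.U_rec2 u (by simpa [u] using hU0) (by
    intro n hn
    rw [← hUrec n hn]
    refine Finset.sum_congr rfl fun k _ => ?_
    rw [St8.NMpoly_eq, Nat.cast_smul_eq_nsmul])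
  have h1 := St8.U_rec u (by simpa [u] using hU0) (by
    intro n hn
    rw [← hUrec n hn]
    refine Finset.sum_congr rfl fun k _ => ?_
    rw [St8.NMpoly_eq, Nat.cast_smul_eq_nsmul]) 0
  intro n
  change u (2 * n + 1) = _
  induction n with
  | zero => simpa using h1
  | succ n ih =>
    have e : 2 * (n + 1) + 1 = (2 * n + 1) + 2 := by ring
    rw [e, hrec, ih, Finset.sum_range_succ _ (n + 1), Finset.mul_sum]
    congr 1
    · refine Finset.sum_congr rfl fun i hi => ?_
      have hi' : i ≤ n := by simpa [Nat.lt_succ_iff] using hi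
      have e2 : n + 1 - i = (n - i) + 1 := by omega
      rw [e2, Finset.prod_range_succ']
      have e3 : ∀ j, 2 * (n + 1) - 2 * (j + 1) = 2 * n - 2 * j := by intro j; omega
      simp only [e3, mul_zero, Nat.sub_zero]
      push_cast
      ring
    · simp
      congr 1
      ring
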